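/- Every complete multipartite graph that is not IC-planar contains a subgraph isomorphic to K_{3,4} or to K_{1,1,1,1,2}. -/

import Mathlib

open Set

/-- Two subsets of the plane *properly cross* at a point `p`: in some open
neighbourhood of `p` the pair of sets looks, up to homeomorphism, like the two
coordinate axes meeting at the origin. -/
def ProperCross (A₁ A₂ : Set (ℝ × ℝ)) (p : ℝ × ℝ) : Prop :=
  ∃ U : Set (ℝ × ℝ), IsOpen U ∧ ∃ hp : p ∈ U, ∃ φ : U ≃ₜ (ℝ × ℝ),
    φ ⟨p, hp⟩ = (0, 0) ∧
    (fun x => φ x) '' {x : U | (x : ℝ × ℝ) ∈ A₁} = {q : ℝ × ℝ | q.2 = 0} ∧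
    (fun x => φ x) '' {x : U | (x : ℝ × ℝ) ∈ A₂} = {q : ℝ × ℝ | q.1 = 0}

/-- A drawing of a simple graph `G` in the plane: vertices go to distinct points,
each edge is drawn as a continuous injective arc joining the points of its two
endpoints, no arc passes through the point of a vertex other than its endpoints,
arcs of edges sharing an endpoint meet only at that common point, any two arcs
meet in finitely many points, every intersection point of two arcs that is not a
common endpoint is a proper crossing, and no point of the plane that is not a
vertex point lies on more than two arcs. -/
structure Drawing {V : Type*} (G : SimpleGraph V) where
  pos : V → ℝ × ℝ
  pos_inj : Function.Injective pos
  arc : G.edgeSet → ℝ → ℝ × ℝ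
  arc_cont : ∀ e, ContinuousOn (arc e) (Icc 0 1)
  arc_inj : ∀ e, InjOn (arc e) (Icc 0 1)
  arc_ends : ∀ e : G.edgeSet, ∃ u v : V, (e : Sym2 V) = s(u, v) ∧
    arc e 0 = pos u ∧ arc e 1 = pos v
  no_vertex_interior : ∀ (e : G.edgeSet) (v : V), v ∉ (e : Sym2 V) →
    pos v ∉ arc e '' Icc 0 1
  shared_endpoint : ∀ e₁ e₂ : G.edgeSet, e₁ ≠ e₂ → ∀ v : V,
    v ∈ (e₁ : Sym2 V) → v ∈ (e₂ : Sym2 V) →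
    arc e₁ '' Icc 0 1 ∩ arc e₂ '' Icc 0 1 ⊆ {pos v}
  finite_meet : ∀ e₁ e₂ : G.edgeSet, e₁ ≠ e₂ →
    (arc e₁ '' Icc 0 1 ∩ arc e₂ '' Icc 0 1).Finite
  proper : ∀ e₁ e₂ : G.edgeSet, e₁ ≠ e₂ →
    ∀ p ∈ arc e₁ '' Icc 0 1 ∩ arc e₂ '' Icc 0 1, p ∉ Set.range pos →
    ProperCross (arc e₁ '' Icc 0 1) (arc e₂ '' Icc 0 1) p
  at_most_two : ∀ p : ℝ × ℝ, p ∉ Set.range pos →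
    ∀ e₁ e₂ e₃ : G.edgeSet, p ∈ arc e₁ '' Icc 0 1 → p ∈ arc e₂ '' Icc 0 1 →
      p ∈ arc e₃ '' Icc 0 1 → e₁ = e₂ ∨ e₁ = e₃ ∨ e₂ = e₃

namespace Drawing

variable {V : Type*} {G : SimpleGraph V}

/-- The image of the arc drawn for the edge `e`. -/
def arcIm (D : Drawing G) (e : G.edgeSet) : Set (ℝ × ℝ) :=
  D.arc e '' Icc 0 1

/-- The set of crossings of the drawing: points that are not vertex points and
lie on (at least, hence exactly) two arcs.  (An intersection point of two arcs
that is a common endpoint of the two edges is a vertex point, and conversely a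
vertex point on two arcs is a common endpoint, so these are precisely the
intersection points of pairs of arcs that are not common endpoints.) -/
def crossings (D : Drawing G) : Set (ℝ × ℝ) :=
  {p | p ∉ Set.range D.pos ∧ ∃ e₁ e₂ : G.edgeSet, e₁ ≠ e₂ ∧ p ∈ D.arcIm e₁ ∧ p ∈ D.arcIm e₂}

/-- The number of crossings of the drawing. -/
noncomputable def crossingCount (D : Drawing G) : ℕ := D.crossings.ncard

/-- The cluster set `S(c)` of a crossing `c`: the set of end-vertices of the
(two) edges whose arcs pass through `c`. -/
def cluster (D : Drawing G) (c : ℝ × ℝ) : Set V :=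
  {v | ∃ e : G.edgeSet, c ∈ D.arcIm e ∧ v ∈ (e : Sym2 V)}

/-- A drawing is 1-planar if each edge's arc is crossed at most once. -/
def IsOnePlanar (D : Drawing G) : Prop :=
  ∀ e : G.edgeSet, {p | p ∈ D.crossings ∧ p ∈ D.arcIm e}.Subsingleton

/-- A drawing is NIC-planar if it is 1-planar and the cluster sets of any two
distinct crossings share at most one vertex. -/
def IsNICPlanar (D : Drawing G) : Prop :=
  D.IsOnePlanar ∧ ∀ c₁ ∈ D.crossings, ∀ c₂ ∈ D.crossings, c₁ ≠ c₂ →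
    (D.cluster c₁ ∩ D.cluster c₂).ncard ≤ 1

/-- A drawing is IC-planar if it is 1-planar and the cluster sets of any two
distinct crossings are disjoint. -/
def IsICPlanar (D : Drawing G) : Prop :=
  D.IsOnePlanar ∧ ∀ c₁ ∈ D.crossings, ∀ c₂ ∈ D.crossings, c₁ ≠ c₂ →
    D.cluster c₁ ∩ D.cluster c₂ = ∅

end Drawing

/-- A graph is 1-planar if it admits a 1-planar drawing. -/
def SimpleGraph.OnePlanar {V : Type*} (G : SimpleGraph V) : Prop :=
  ∃ D : Drawing G, D.IsOnePlanar

/-- A graph is NIC-planar if it admits an NIC-planar drawing. -/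
def SimpleGraph.NICPlanar {V : Type*} (G : SimpleGraph V) : Prop :=
  ∃ D : Drawing G, D.IsNICPlanar

/-- A graph is IC-planar if it admits an IC-planar drawing. -/
def SimpleGraph.ICPlanar {V : Type*} (G : SimpleGraph V) : Prop :=
  ∃ D : Drawing G, D.IsICPlanar

/-- The crossing number of `G`: the minimum number of crossings over all
drawings of `G`. -/
noncomputable def SimpleGraph.crossingNumber {V : Type*} (G : SimpleGraph V) : ℕ :=
  sInf {n | ∃ D : Drawing G, D.crossingCount = n}
/-- The graph `H` is a minimum non-NIC-planar graph: `H` is not NIC-planar but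
deleting any single edge of `H` yields an NIC-planar graph. -/
def MinNonNICPlanar {V : Type*} (H : SimpleGraph V) : Prop :=
  ¬ H.NICPlanar ∧ ∀ e ∈ H.edgeSet, (H.deleteEdges {e}).NICPlanar

/-- The graph `H` is a minimum non-IC-planar graph: `H` is not IC-planar but
deleting any single edge of `H` yields an IC-planar graph. -/
def MinNonICPlanar {V : Type*} (H : SimpleGraph V) : Prop :=
  ¬ H.ICPlanar ∧ ∀ e ∈ H.edgeSet, (H.deleteEdges {e}).ICPlanar

/-- The complete multipartite graph with parts of sizes `a 0, …, a (k-1)`. -/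
abbrev completeMultipartite {k : ℕ} (a : Fin k → ℕ) :
    SimpleGraph (Σ i : Fin k, Fin (a i)) :=
  SimpleGraph.completeMultipartiteGraph fun i => Fin (a i)

/-- `G` contains a subgraph isomorphic to `H`, i.e. there is an injective graph
homomorphism from `H` to `G`. -/
def ContainsSubgraphIso {V W : Type*} (G : SimpleGraph V) (H : SimpleGraph W) : Prop :=
  ∃ f : H →g G, Function.Injective f

/-! ### Straight-line drawings with at most one crossing -/

namespace StraightLine

/-- The orientation determinant of the triangle `p q r`. -/
def orient {R : Type*} [CommRing R] (p q r : R × R) : R :=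
  (q.1 - p.1) * (r.2 - p.2) - (q.2 - p.2) * (r.1 - p.1)

/-- The segment `p q` is horizontal, the segment `r s` is vertical, and both contain the origin
in their interior. -/
def AxisCross {R : Type*} [CommRing R] [LT R] (p q r s : R × R) : Prop :=
  (p.2 = 0 ∧ q.2 = 0 ∧ p.1 * q.1 < 0) ∧ (r.1 = 0 ∧ s.1 = 0 ∧ r.2 * s.2 < 0)

instance (p q r s : ℤ × ℤ) : Decidable (AxisCross p q r s) :=
  inferInstanceAs (Decidable (_ ∧ _))

/-- Integer coordinates `P` for which the straight-line drawing of the complete multipartite graph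
with colour classes given by `f` has no crossing apart from (possibly) one at the origin, between
an edge on the horizontal axis and an edge on the vertical axis. -/
structure IsStraightIC {W C : Type*} (f : W → C) (P : W → ℤ × ℤ) : Prop where
  inj : Function.Injective P
  generic : ∀ u v w, f u ≠ f v → w ≠ u → w ≠ v → orient (P u) (P v) (P w) ≠ 0
  separated : ∀ u v w x, f u ≠ f v → f w ≠ f x → u ≠ w → u ≠ x → v ≠ w → v ≠ x →
    0 < orient (P u) (P v) (P w) * orient (P u) (P v) (P x) ∨
    0 < orient (P w) (P x) (P u) * orient (P w) (P x) (P v) ∨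
    AxisCross (P u) (P v) (P w) (P x) ∨ AxisCross (P w) (P x) (P u) (P v)

/-- The inclusion of the integer lattice in the plane. -/
def toPlane (p : ℤ × ℤ) : ℝ × ℝ := (p.1, p.2)

lemma toPlane_injective : Function.Injective toPlane := by
  rintro ⟨a, b⟩ ⟨c, d⟩ h
  simpa [toPlane] using h

lemma orient_toPlane (p q r : ℤ × ℤ) :
    orient (toPlane p) (toPlane q) (toPlane r) = (orient p q r : ℤ) := by
  simp [orient, toPlane]

lemma mem_segment_iff {p q z : ℝ × ℝ} :
    z ∈ segment ℝ p q ↔ ∃ t ∈ Icc (0 : ℝ) 1,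
      z.1 = p.1 + t * (q.1 - p.1) ∧ z.2 = p.2 + t * (q.2 - p.2) := by
  rw [segment_eq_image']
  constructor
  · rintro ⟨t, ht, rfl⟩
    exact ⟨t, ht, by simp, by simp⟩
  · rintro ⟨t, ht, h1, h2⟩
    exact ⟨t, ht, Prod.ext (by simp [h1]) (by simp [h2])⟩

lemma orient_eq_zero_of_mem_segment {p q z : ℝ × ℝ} (h : z ∈ segment ℝ p q) :
    orient p q z = 0 := by
  obtain ⟨t, -, h1, h2⟩ := mem_segment_iff.1 h
  rw [orient, h1, h2]
  ring

lemma disjoint_segment_of_orient {p q r s z : ℝ × ℝ} (h : 0 < orient p q r * orient p q s)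
    (h₁ : z ∈ segment ℝ p q) (h₂ : z ∈ segment ℝ r s) : False := by
  obtain ⟨t, ht, h3, h4⟩ := mem_segment_iff.1 h₂
  have key : orient p q z = (1 - t) * orient p q r + t * orient p q s := by
    rw [orient, h3, h4, orient, orient]
    ring
  rw [orient_eq_zero_of_mem_segment h₁] at key
  have ht0 := ht.1
  have ht1 : 0 ≤ 1 - t := by linarith [ht.2]
  rcases pos_and_pos_or_neg_and_neg_of_mul_pos h with ⟨ha, hb⟩ | ⟨ha, hb⟩ <;>
    rcases ht0.eq_or_lt with rfl | h0 <;> nlinarith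

/-- Two segments with a common endpoint which are not collinear meet only there. -/
lemma eq_of_mem_segment_of_orient_ne_zero {p q r z : ℝ × ℝ} (h : orient p q r ≠ 0)
    (h₁ : z ∈ segment ℝ p q) (h₂ : z ∈ segment ℝ p r) : z = p := by
  obtain ⟨t, -, h3, h4⟩ := mem_segment_iff.1 h₂
  have key : t * orient p q r = 0 := by
    rw [← orient_eq_zero_of_mem_segment h₁, orient, orient, h3, h4]
    ring
  obtain rfl := (mul_eq_zero.1 key).resolve_right h
  exact Prod.ext (by simpa using h3) (by simpa using h4)

lemma AxisCross.eq_zero {p q r s z : ℝ × ℝ} (h : AxisCross p q r s)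
    (h₁ : z ∈ segment ℝ p q) (h₂ : z ∈ segment ℝ r s) : z = 0 := by
  obtain ⟨⟨hp, hq, -⟩, hr, hs, -⟩ := h
  obtain ⟨t, -, -, h4⟩ := mem_segment_iff.1 h₁
  obtain ⟨t', -, h5, -⟩ := mem_segment_iff.1 h₂
  exact Prod.ext (by simp [h5, hr, hs]) (by simp [h4, hp, hq])

lemma properCross_symm {A B : Set (ℝ × ℝ)} {p : ℝ × ℝ} (h : ProperCross A B p) :
    ProperCross B A p := by
  obtain ⟨U, hU, hp, φ, h0, h1, h2⟩ := h
  refine ⟨U, hU, hp, φ.trans (Homeomorph.prodComm ℝ ℝ), by simp [h0], ?_, ?_⟩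
  · have := congrArg (fun S => Prod.swap '' S) h2
    simp only [image_image] at this
    refine Eq.trans this ?_
    ext ⟨x, y⟩
    simp [eq_comm]
  · have := congrArg (fun S => Prod.swap '' S) h1
    simp only [image_image] at this
    refine Eq.trans this ?_
    ext ⟨x, y⟩
    simp [eq_comm]

lemma exists_mem_Icc_of_abs_lt {a b x : ℝ} (hab : a * b < 0) (ha : 1 ≤ |a|) (hb : 1 ≤ |b|)
    (hx : |x| < 1) : ∃ t ∈ Icc (0 : ℝ) 1, x = a + t * (b - a) := by
  have hne : b - a ≠ 0 := fun h => by
    rw [sub_eq_zero.1 h] at hab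
    exact (mul_self_nonneg a).not_gt hab
  refine ⟨(x - a) / (b - a), ?_, by field_simp; ring⟩
  rw [abs_lt] at hx
  rcases mul_neg_iff.1 hab with ⟨h1, h2⟩ | ⟨h1, h2⟩
  · rw [abs_of_pos h1] at ha
    rw [abs_of_neg h2] at hb
    exact ⟨div_nonneg_of_nonpos (by linarith) (by linarith),
      (div_le_one_of_neg (by linarith)).2 (by linarith)⟩
  · rw [abs_of_neg h1] at ha
    rw [abs_of_pos h2] at hb
    exact ⟨div_nonneg (by linarith) (by linarith),
      (div_le_one (by linarith)).2 (by linarith)⟩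

lemma one_le_abs_cast_of_mul_neg {m n : ℤ} (h : m * n < 0) :
    1 ≤ |(m : ℝ)| ∧ 1 ≤ |(n : ℝ)| := by
  have hm : m ≠ 0 := by rintro rfl; simp at h
  have hn : n ≠ 0 := by rintro rfl; simp at h
  exact ⟨by exact_mod_cast Int.one_le_abs hm, by exact_mod_cast Int.one_le_abs hn⟩

lemma unitBall_symm_image {A : Set (ℝ × ℝ)} {T : Set (ℝ × ℝ)}
    (hA : ∀ z ∈ Metric.ball (0 : ℝ × ℝ) 1, z ∈ A ↔ z ∈ T)
    (hT : ∀ c : ℝ, c ≠ 0 → ∀ z, c • z ∈ T ↔ z ∈ T) :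
    (fun x => (Homeomorph.unitBall (E := ℝ × ℝ)).symm x) ''
      {x : Metric.ball (0 : ℝ × ℝ) 1 | (x : ℝ × ℝ) ∈ A} = T := by
  have key : ∀ y : ℝ × ℝ, ((Homeomorph.unitBall y : Metric.ball (0 : ℝ × ℝ) 1) : ℝ × ℝ) ∈ A ↔
      y ∈ T := by
    intro y
    rw [hA _ (Subtype.coe_prop _), Homeomorph.unitBall_apply_coe]
    refine hT _ (inv_ne_zero (Real.sqrt_ne_zero'.2 (by positivity))) y
  ext y
  constructor
  · rintro ⟨x, hx, rfl⟩
    rw [← key]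
    simpa using hx
  · intro hy
    exact ⟨Homeomorph.unitBall y, (key y).2 hy, by simp⟩

lemma AxisCross.properCross {p q r s : ℤ × ℤ} (h : AxisCross p q r s) :
    ProperCross (segment ℝ (toPlane p) (toPlane q)) (segment ℝ (toPlane r) (toPlane s)) 0 := by
  obtain ⟨⟨hp, hq, hpq⟩, hr, hs, hrs⟩ := h
  obtain ⟨hp1, hq1⟩ := one_le_abs_cast_of_mul_neg hpq
  obtain ⟨hr1, hs1⟩ := one_le_abs_cast_of_mul_neg hrs
  refine ⟨Metric.ball 0 1, Metric.isOpen_ball, by simp, Homeomorph.unitBall.symm, ?_, ?_, ?_⟩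
  · rw [Homeomorph.symm_apply_eq]
    exact Subtype.ext Homeomorph.coe_unitBall_apply_zero.symm
  · refine unitBall_symm_image ?_ (by intro c hc z; simp [hc])
    intro z hz
    rw [mem_ball_zero_iff, Prod.norm_def, max_lt_iff, Real.norm_eq_abs, Real.norm_eq_abs] at hz
    rw [mem_segment_iff]
    constructor
    · rintro ⟨t, -, -, h2⟩
      simpa [toPlane, hp, hq] using h2
    · intro h2
      obtain ⟨t, ht, h1⟩ := exists_mem_Icc_of_abs_lt (by exact_mod_cast hpq) hp1 hq1 hz.1
      exact ⟨t, ht, h1, by simpa [toPlane, hp, hq] using h2⟩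
  · refine unitBall_symm_image ?_ (by intro c hc z; simp [hc])
    intro z hz
    rw [mem_ball_zero_iff, Prod.norm_def, max_lt_iff, Real.norm_eq_abs, Real.norm_eq_abs] at hz
    rw [mem_segment_iff]
    constructor
    · rintro ⟨t, -, h2, -⟩
      simpa [toPlane, hr, hs] using h2
    · intro h2
      obtain ⟨t, ht, h1⟩ := exists_mem_Icc_of_abs_lt (by exact_mod_cast hrs) hr1 hs1 hz.2
      exact ⟨t, ht, by simpa [toPlane, hr, hs] using h2, h1⟩

section Drawing

variable {V W C : Type*} {G : SimpleGraph V} {f : W → C} {P : W → ℤ × ℤ} {g : V → W}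

/-- The two endpoints of an edge, in an arbitrary order. -/
noncomputable def ends (e : G.edgeSet) : V × V := Quot.out e.1

lemma mk_ends (e : G.edgeSet) : s((ends e).1, (ends e).2) = e.1 := Quot.out_eq e.1

lemma adj_ends (e : G.edgeSet) : G.Adj (ends e).1 (ends e).2 := by
  rw [← SimpleGraph.mem_edgeSet, mk_ends]
  exact e.2

lemma mem_iff_ends (e : G.edgeSet) (v : V) :
    v ∈ (e : Sym2 V) ↔ v = (ends e).1 ∨ v = (ends e).2 := by
  rw [← mk_ends e, Sym2.mem_iff]

/-- The segment representing an edge in the straight-line drawing. -/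
noncomputable def edgeSegment (P : W → ℤ × ℤ) (g : V → W) (e : G.edgeSet) : Set (ℝ × ℝ) :=
  segment ℝ (toPlane (P (g (ends e).1))) (toPlane (P (g (ends e).2)))

/-- The two edges are drawn on the horizontal and the vertical axis respectively. -/
def EdgeCross (P : W → ℤ × ℤ) (g : V → W) (e₁ e₂ : G.edgeSet) : Prop :=
  AxisCross (P (g (ends e₁).1)) (P (g (ends e₁).2)) (P (g (ends e₂).1)) (P (g (ends e₂).2))


lemma exists_edgeSegment_eq {e : G.edgeSet} {v : V} (h : v ∈ (e : Sym2 V)) :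
    ∃ w, (e : Sym2 V) = s(v, w) ∧ G.Adj v w ∧
      edgeSegment P g e = segment ℝ (toPlane (P (g v))) (toPlane (P (g w))) := by
  rcases (mem_iff_ends e v).1 h with rfl | rfl
  · exact ⟨_, (mk_ends e).symm, adj_ends e, rfl⟩
  · exact ⟨_, by rw [Sym2.eq_swap, mk_ends], (adj_ends e).symm, segment_symm _ _ _⟩

lemma IsStraightIC.orient_ne_zero (hP : IsStraightIC f P) (hg : Function.Injective g)
    (hfg : ∀ u v, G.Adj u v → f (g u) ≠ f (g v)) {u v w : V} (huv : G.Adj u v)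
    (hu : w ≠ u) (hv : w ≠ v) :
    orient (toPlane (P (g u))) (toPlane (P (g v))) (toPlane (P (g w))) ≠ 0 := by
  rw [orient_toPlane]
  exact_mod_cast hP.generic _ _ _ (hfg _ _ huv) (hg.ne hu) (hg.ne hv)

lemma IsStraightIC.notMem_edgeSegment (hP : IsStraightIC f P) (hg : Function.Injective g)
    (hfg : ∀ u v, G.Adj u v → f (g u) ≠ f (g v)) {e : G.edgeSet} {v : V}
    (h : v ∉ (e : Sym2 V)) : toPlane (P (g v)) ∉ edgeSegment P g e := by
  rw [mem_iff_ends, not_or] at h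
  exact fun hmem => hP.orient_ne_zero hg hfg (adj_ends e) h.1 h.2
    (orient_eq_zero_of_mem_segment hmem)

lemma IsStraightIC.eq_of_common_end (hP : IsStraightIC f P) (hg : Function.Injective g)
    (hfg : ∀ u v, G.Adj u v → f (g u) ≠ f (g v)) {e₁ e₂ : G.edgeSet} (hne : e₁ ≠ e₂) {v : V}
    (h₁ : v ∈ (e₁ : Sym2 V)) (h₂ : v ∈ (e₂ : Sym2 V)) {z : ℝ × ℝ}
    (hz₁ : z ∈ edgeSegment P g e₁) (hz₂ : z ∈ edgeSegment P g e₂) :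
    z = toPlane (P (g v)) := by
  obtain ⟨w, he, hvw, hs⟩ := exists_edgeSegment_eq (P := P) (g := g) h₁
  obtain ⟨w', he', hvw', hs'⟩ := exists_edgeSegment_eq (P := P) (g := g) h₂
  rw [hs] at hz₁
  rw [hs'] at hz₂
  refine eq_of_mem_segment_of_orient_ne_zero
    (hP.orient_ne_zero hg hfg hvw hvw'.ne' ?_) hz₁ hz₂
  rintro rfl
  exact hne (Subtype.ext (he.trans he'.symm))

lemma IsStraightIC.edgeCross (hP : IsStraightIC f P) (hg : Function.Injective g)
    (hfg : ∀ u v, G.Adj u v → f (g u) ≠ f (g v)) {e₁ e₂ : G.edgeSet} (hne : e₁ ≠ e₂)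
    {z : ℝ × ℝ} (hz₁ : z ∈ edgeSegment P g e₁) (hz₂ : z ∈ edgeSegment P g e₂)
    (hz : z ∉ range fun v => toPlane (P (g v))) :
    z = 0 ∧ (EdgeCross P g e₁ e₂ ∨ EdgeCross P g e₂ e₁) := by
  have hdisj : ∀ v w, v ∈ (e₁ : Sym2 V) → w ∈ (e₂ : Sym2 V) → g v ≠ g w := by
    intro v w hv hw h
    obtain rfl := hg h
    exact hz ⟨v, (hP.eq_of_common_end hg hfg hne hv hw hz₁ hz₂).symm⟩
  have m1 (e : G.edgeSet) : (ends e).1 ∈ (e : Sym2 V) := (mem_iff_ends _ _).2 (Or.inl rfl)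
  have m2 (e : G.edgeSet) : (ends e).2 ∈ (e : Sym2 V) := (mem_iff_ends _ _).2 (Or.inr rfl)
  have toReal {p q r s : ℤ × ℤ} (h : AxisCross p q r s) :
      AxisCross (toPlane p) (toPlane q) (toPlane r) (toPlane s) := by
    simp only [AxisCross, toPlane] at h ⊢
    exact_mod_cast h
  have sep {p q r s : ℤ × ℤ} (h : 0 < orient p q r * orient p q s)
      (h₁ : z ∈ segment ℝ (toPlane p) (toPlane q)) (h₂ : z ∈ segment ℝ (toPlane r) (toPlane s)) :
      False := by
    refine disjoint_segment_of_orient ?_ h₁ h₂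
    rw [orient_toPlane, orient_toPlane]
    exact_mod_cast h
  rcases hP.separated _ _ _ _ (hfg _ _ (adj_ends e₁)) (hfg _ _ (adj_ends e₂))
    (hdisj _ _ (m1 e₁) (m1 e₂)) (hdisj _ _ (m1 e₁) (m2 e₂)) (hdisj _ _ (m2 e₁) (m1 e₂))
    (hdisj _ _ (m2 e₁) (m2 e₂)) with h | h | h | h
  · exact (sep h hz₁ hz₂).elim
  · exact (sep h hz₂ hz₁).elim
  · exact ⟨(toReal h).eq_zero hz₁ hz₂, Or.inl h⟩
  · exact ⟨(toReal h).eq_zero hz₂ hz₁, Or.inr h⟩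

lemma EdgeCross.not_right {e₁ e₂ e₃ : G.edgeSet} (h : EdgeCross P g e₁ e₂) :
    ¬ EdgeCross P g e₃ e₁ := by
  rintro ⟨-, h1, -, -⟩
  simpa [h1] using h.1.2.2

lemma EdgeCross.not_left {e₁ e₂ e₃ : G.edgeSet} (h : EdgeCross P g e₁ e₂) :
    ¬ EdgeCross P g e₂ e₃ :=
  fun h' => h'.not_right h

/-- The parametrization of the segment representing an edge. -/
noncomputable def edgeArc (P : W → ℤ × ℤ) (g : V → W) (e : G.edgeSet) (t : ℝ) : ℝ × ℝ :=
  AffineMap.lineMap (toPlane (P (g (ends e).1))) (toPlane (P (g (ends e).2))) t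

lemma edgeArc_image (e : G.edgeSet) : edgeArc P g e '' Icc 0 1 = edgeSegment P g e :=
  (segment_eq_image_lineMap ℝ _ _).symm

/-- The straight-line drawing given by suitable integer coordinates. -/
noncomputable def IsStraightIC.drawing (hP : IsStraightIC f P) (hg : Function.Injective g)
    (hfg : ∀ u v, G.Adj u v → f (g u) ≠ f (g v)) : Drawing G where
  pos v := toPlane (P (g v))
  pos_inj := toPlane_injective.comp (hP.inj.comp hg)
  arc := edgeArc P g
  arc_cont e := AffineMap.lineMap_continuous.continuousOn
  arc_inj e := (AffineMap.lineMap_injective ℝ fun h =>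
    (adj_ends e).ne (hg (hP.inj (toPlane_injective h)))).injOn
  arc_ends e := ⟨_, _, (mk_ends e).symm, by simp [edgeArc], by simp [edgeArc]⟩
  no_vertex_interior e v h := by
    rw [edgeArc_image]
    exact hP.notMem_edgeSegment hg hfg h
  shared_endpoint e₁ e₂ hne v h₁ h₂ z hz := by
    rw [edgeArc_image, edgeArc_image] at hz
    exact hP.eq_of_common_end hg hfg hne h₁ h₂ hz.1 hz.2
  finite_meet e₁ e₂ hne := by
    rw [edgeArc_image, edgeArc_image]
    have hsub : (edgeSegment P g e₁ ∩ edgeSegment P g e₂) ⊆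
        insert 0 ((fun v => toPlane (P (g v))) '' {(ends e₁).1, (ends e₁).2}) := by
      rintro z ⟨hz₁, hz₂⟩
      by_cases hz : z ∈ range fun v => toPlane (P (g v))
      · obtain ⟨v, rfl⟩ := hz
        by_cases hv : v ∈ (e₁ : Sym2 V)
        · exact Or.inr ⟨v, (mem_iff_ends e₁ v).1 hv, rfl⟩
        · exact (hP.notMem_edgeSegment hg hfg hv hz₁).elim
      · exact Or.inl (hP.edgeCross hg hfg hne hz₁ hz₂ hz).1
    exact (((toFinite _).image _).insert 0).subset hsub
  proper e₁ e₂ hne z hz hpos := by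
    rw [edgeArc_image, edgeArc_image] at hz ⊢
    obtain ⟨rfl, h | h⟩ := hP.edgeCross hg hfg hne hz.1 hz.2 hpos
    · exact h.properCross
    · exact properCross_symm h.properCross
  at_most_two z hz e₁ e₂ e₃ h₁ h₂ h₃ := by
    rw [edgeArc_image] at h₁ h₂ h₃
    by_contra! hne
    rcases (hP.edgeCross hg hfg hne.1 h₁ h₂ hz).2 with h | h <;>
    rcases (hP.edgeCross hg hfg hne.2.1 h₁ h₃ hz).2 with h' | h' <;>
    rcases (hP.edgeCross hg hfg hne.2.2 h₂ h₃ hz).2 with h'' | h''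
    all_goals first
      | exact h.not_right h'
      | exact h.not_left h'
      | exact h.not_right h''
      | exact h.not_left h''
      | exact h'.not_right h
      | exact h'.not_right h''
      | exact h'.not_left h''

/-- A graph that maps injectively to a complete multipartite graph with a straight-line drawing
with at most one crossing is IC-planar. -/
theorem IsStraightIC.icPlanar (hP : IsStraightIC f P) (hg : Function.Injective g)
    (hfg : ∀ u v, G.Adj u v → f (g u) ≠ f (g v)) : G.ICPlanar := by
  have hzero : ∀ z ∈ (hP.drawing hg hfg).crossings, z = 0 := by
    rintro z ⟨hz, e₁, e₂, hne, h₁, h₂⟩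
    have h₁' : z ∈ edgeArc P g e₁ '' Icc 0 1 := h₁
    have h₂' : z ∈ edgeArc P g e₂ '' Icc 0 1 := h₂
    rw [edgeArc_image] at h₁' h₂'
    exact (hP.edgeCross hg hfg hne h₁' h₂' hz).1
  refine ⟨hP.drawing hg hfg, fun e z hz z' hz' => ?_, fun c₁ h₁ c₂ h₂ hne => ?_⟩
  · rw [hzero z hz.1, hzero z' hz'.1]
  · exact (hne ((hzero c₁ h₁).trans (hzero c₂ h₂).symm)).elim

end Drawing

end StraightLine

section Combinatorics

open StraightLine

/-- A straight-line drawing of `K₅` with one crossing. -/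
lemma isStraightIC_five : IsStraightIC (id : Fin 5 → Fin 5)
    ![(-1, 0), (3, 0), (0, -3), (0, 1), (-3, 3)] where
  inj := by decide
  generic := by decide +kernel
  separated := by decide +kernel

/-- A straight-line drawing of `K_{3,1,1,1}` with one crossing. -/
lemma isStraightIC_triple : IsStraightIC (![0, 0, 0, 1, 2, 3] : Fin 6 → ℕ)
    ![(-1, 1), (0, -3), (3, 0), (-1, 0), (0, 1), (-3, 3)] where
  inj := by decide
  generic := by decide +kernel
  separated := by decide +kernel

/-- A straight-line drawing of `K_{2,2,1,1}` with one crossing. -/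
lemma isStraightIC_two_pairs : IsStraightIC (![0, 0, 1, 1, 2, 3] : Fin 6 → ℕ)
    ![(2, -2), (-1, 0), (-3, -2), (1, 0), (0, 3), (0, -1)] where
  inj := by decide
  generic := by decide +kernel
  separated := by decide +kernel

/-- Coordinates for a straight-line drawing of `K_{1,1,m}` without crossings. -/
def spindle : Fin 2 ⊕ ℕ → ℤ × ℤ :=
  Sum.elim ![(0, 1), (0, -1)] fun n => (n + 1, 0)

/-- Independent edges of the spindle drawing are separated by the line through one of them. -/
lemma spindle_separated {i j : Fin 2} {m n : ℕ} (hij : i ≠ j) (hmn : m ≠ n) :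
    0 < orient (spindle (.inl i)) (spindle (.inr m)) (spindle (.inl j)) *
      orient (spindle (.inl i)) (spindle (.inr m)) (spindle (.inr n)) ∨
    0 < orient (spindle (.inl j)) (spindle (.inr n)) (spindle (.inl i)) *
      orient (spindle (.inl j)) (spindle (.inr n)) (spindle (.inr m)) := by
  have key : 0 < 2 * ((m : ℤ) + 1) * (m - n) ∨ 0 < 2 * ((n : ℤ) + 1) * (n - m) := by
    rcases hmn.lt_or_gt with h | h
    · exact Or.inr (mul_pos (by omega) (by omega))
    · exact Or.inl (mul_pos (by omega) (by omega))
  fin_cases i <;> fin_cases j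
  · simp at hij
  · convert key using 2 <;> simp [spindle, orient, -mul_eq_mul_right_iff] <;> ring
  · convert key using 2 <;> simp [spindle, orient, -mul_eq_mul_right_iff] <;> ring
  · simp at hij

lemma isStraightIC_spindle :
    IsStraightIC (Sum.elim some fun _ => none : Fin 2 ⊕ ℕ → Option (Fin 2)) spindle where
  inj := by
    rintro (u | u) (v | v) h
    · revert u v
      decide
    · fin_cases u <;> simp [spindle] at h
    · fin_cases v <;> simp [spindle] at h
    · simpa [spindle] using h
  generic := by
    rintro (u | u) (v | v) (w | w) h h1 h2
    · fin_cases u <;> fin_cases v <;> fin_cases w <;> simp at h h1 h2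
    on_goal 6 => simp at h
    on_goal 6 => simp at h
    all_goals
      first
      | (fin_cases u <;> fin_cases v <;> simp [spindle, orient] at * <;> omega)
      | (fin_cases u <;> fin_cases w <;> simp [spindle, orient] at * <;> omega)
      | (fin_cases v <;> fin_cases w <;> simp [spindle, orient] at * <;> omega)
      | (fin_cases u <;> simp [spindle, orient] at * <;> omega)
      | (fin_cases v <;> simp [spindle, orient] at * <;> omega)
  separated := by
    have swap (p q r s : ℤ × ℤ) : orient p q r * orient p q s = orient q p r * orient q p s := by
      simp only [orient]
      ring
    have fin_two : ∀ {a b c : Fin 2}, a ≠ b → c ≠ a → c ≠ b → False := by decide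
    rintro (u | u) (v | v) (w | w) (x | x) h h' h1 h2 h3 h4 <;>
      simp only [ne_eq, Sum.inl.injEq, Sum.inr.injEq, Sum.elim_inl, Sum.elim_inr,
        Option.some.injEq, not_true_eq_false] at h h' h1 h2 h3 h4
    · exact (fin_two h (Ne.symm h1) (Ne.symm h3)).elim
    · exact (fin_two h (Ne.symm h1) (Ne.symm h3)).elim
    · exact (fin_two h (Ne.symm h2) (Ne.symm h4)).elim
    · exact (fin_two h' h1 h2).elim
    · exact (spindle_separated h1 h4).imp_right Or.inl
    · rw [mul_comm, swap (spindle (.inr w))]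
      exact (spindle_separated h2 h3).imp_right Or.inl
    · exact (fin_two h' h3 h4).elim
    · rw [swap (spindle (.inr u)), mul_comm (orient (spindle (.inl w)) _ _)]
      exact (spindle_separated h3 h2).imp_right Or.inl
    · rw [swap (spindle (.inr u)), swap (spindle (.inr w)),
        mul_comm, mul_comm (orient (spindle (.inl x)) _ _)]
      exact (spindle_separated h4 h1).imp_right Or.inl

variable {k : ℕ} {a : Fin k → ℕ}

lemma card_fst_mem (S : Finset (Fin k)) :
    Fintype.card {v : Σ i : Fin k, Fin (a i) // v.1 ∈ S} = ∑ i ∈ S, a i := by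
  rw [Fintype.card_subtype]
  have : (Finset.univ.filter fun v : Σ i : Fin k, Fin (a i) => v.1 ∈ S) =
      S.sigma fun _ => Finset.univ := by
    ext v
    simp
  rw [this, Finset.card_sigma]
  simp

/-- If all but at most two vertices lie in one part, the graph is IC-planar. -/
lemma icPlanar_of_large_part (i : Fin k) (h : ∑ j ∈ {i}ᶜ, a j ≤ 2) :
    (completeMultipartite a).ICPlanar := by
  have hcard := card_fst_mem (a := a) {i}ᶜ
  obtain ⟨φ⟩ : Nonempty ({v : Σ i : Fin k, Fin (a i) // v.1 ∈ ({i}ᶜ : Finset (Fin k))} ↪ Fin 2) :=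
    Function.Embedding.nonempty_of_card_le (by rw [hcard, Fintype.card_fin]; exact h)
  have hmem {v : Σ i : Fin k, Fin (a i)} (hv : v.1 ≠ i) : v.1 ∈ ({i}ᶜ : Finset (Fin k)) := by
    simpa using hv
  let g : (Σ i : Fin k, Fin (a i)) → Fin 2 ⊕ ℕ := fun v =>
    if hv : v.1 = i then .inr v.2 else .inl (φ ⟨v, hmem hv⟩)
  refine isStraightIC_spindle.icPlanar (g := g) ?_ ?_
  · rintro ⟨u, u'⟩ ⟨v, v'⟩ huv
    by_cases hu : u = i <;> by_cases hv : v = i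
    · subst hu
      subst hv
      simpa [g, Fin.val_inj] using huv
    · simp [g, hu, hv] at huv
    · simp [g, hu, hv] at huv
    · simpa [g, hu, hv] using huv
  · intro u v huv
    have huv' : u.1 ≠ v.1 := huv
    by_cases hu : u.1 = i <;> by_cases hv : v.1 = i
    · exact (huv' (hu.trans hv.symm)).elim
    · simp [g, hu, hv]
    · simp [g, hu, hv]
    · have : u ≠ v := fun h => huv' (by rw [h])
      simpa [g, hu, hv] using this

lemma icPlanar_of_card_le_five (h : ∑ i, a i ≤ 5) : (completeMultipartite a).ICPlanar := by
  obtain ⟨φ⟩ : Nonempty ((Σ i : Fin k, Fin (a i)) ↪ Fin 5) :=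
    Function.Embedding.nonempty_of_card_le (by simpa using h)
  exact isStraightIC_five.icPlanar φ.injective fun u v huv => φ.injective.ne huv.ne

/-- Six vertices, listed so that vertices of the same colour in the model lie in the same part. -/
lemma icPlanar_of_card_six {C : Type*} {f : Fin 6 → C} {P : Fin 6 → ℤ × ℤ}
    (hP : IsStraightIC f P) (h : ∑ i, a i = 6) {e : Fin 6 → Σ i : Fin k, Fin (a i)}
    (he : Function.Injective e) (hf : ∀ i j, f i = f j → (e i).1 = (e j).1) :
    (completeMultipartite a).ICPlanar := by
  have hbij : Function.Bijective e :=
    (Fintype.bijective_iff_injective_and_card e).2 ⟨he, by simp [h]⟩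
  let ε := Equiv.ofBijective e hbij
  refine hP.icPlanar ε.symm.injective fun u v huv hf' => ?_
  have := hf _ _ hf'
  rw [show e (ε.symm u) = u from ε.apply_symm_apply u,
    show e (ε.symm v) = v from ε.apply_symm_apply v] at this
  exact huv this

/-- An injective tuple can be extended to an injective tuple of vertices. -/
lemma exists_extension {α : Type*} [Fintype α] {m n : ℕ} (hm : m ≤ n) (hn : n ≤ Fintype.card α)
    {p : Fin m → α} (hp : Function.Injective p) :
    ∃ e : Fin n → α, Function.Injective e ∧ ∀ i, e (Fin.castLE hm i) = p i := by
  classical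
  induction n, hm using Nat.le_induction with
  | base => exact ⟨p, hp, fun i => rfl⟩
  | succ n hm ih =>
    obtain ⟨e, he, hep⟩ := ih (by omega)
    obtain ⟨x, hx⟩ : ∃ x, x ∉ Finset.univ.image e := by
      by_contra! hall
      have := Finset.card_image_le (s := Finset.univ) (f := e)
      rw [Finset.eq_univ_of_forall hall, Finset.card_univ, Finset.card_univ,
        Fintype.card_fin] at this
      omega
    refine ⟨Fin.snoc e x, Fin.snoc_injective_iff.2 ⟨he, by simpa using hx⟩, fun i => ?_⟩
    rw [← hep i]
    exact Fin.snoc_castSucc (α := fun _ => α) _ _ (Fin.castLE hm i)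

lemma icPlanar_of_triple (h : ∑ i, a i = 6) {i : Fin k} (hi : 3 ≤ a i) :
    (completeMultipartite a).ICPlanar := by
  obtain ⟨e, he, hep⟩ := exists_extension (n := 6) (by norm_num) (by simp [h])
    (p := fun x : Fin 3 => (⟨i, Fin.castLE hi x⟩ : Σ i : Fin k, Fin (a i)))
    (fun x y hxy => by simpa using hxy)
  have h0 : (e 0).1 = i := congrArg Sigma.fst (hep 0)
  have h1 : (e 1).1 = i := congrArg Sigma.fst (hep 1)
  have h2 : (e 2).1 = i := congrArg Sigma.fst (hep 2)
  refine icPlanar_of_card_six isStraightIC_triple h he fun x y hxy => ?_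
  fin_cases x <;> fin_cases y <;> simp_all

lemma icPlanar_of_two_pairs (h : ∑ i, a i = 6) {i j : Fin k} (hij : i ≠ j) (hi : 2 ≤ a i)
    (hj : 2 ≤ a j) : (completeMultipartite a).ICPlanar := by
  obtain ⟨e, he, hep⟩ := exists_extension (n := 6) (by norm_num) (by simp [h])
    (p := (![⟨i, 0, by omega⟩, ⟨i, 1, by omega⟩, ⟨j, 0, by omega⟩, ⟨j, 1, by omega⟩] :
      Fin 4 → Σ i : Fin k, Fin (a i)))
    (fun x y hxy => by
      fin_cases x <;> fin_cases y <;> simp [hij, hij.symm] at hxy ⊢)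
  have h0 : (e 0).1 = i := congrArg Sigma.fst (hep 0)
  have h1 : (e 1).1 = i := congrArg Sigma.fst (hep 1)
  have h2 : (e 2).1 = j := congrArg Sigma.fst (hep 2)
  have h3 : (e 3).1 = j := congrArg Sigma.fst (hep 3)
  refine icPlanar_of_card_six isStraightIC_two_pairs h he fun x y hxy => ?_
  fin_cases x <;> fin_cases y <;> simp_all

/-- A set of parts and its complement with at least three and four vertices give `K_{3,4}`. -/
lemma contains_three_four {S : Finset (Fin k)} (h3 : 3 ≤ ∑ i ∈ S, a i)
    (h4 : 4 ≤ ∑ i ∈ Sᶜ, a i) :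
    ContainsSubgraphIso (completeMultipartite a) (completeMultipartite ![3, 4]) := by
  rw [← card_fst_mem] at h3 h4
  obtain ⟨φ⟩ : Nonempty (Fin 3 ↪ {v : Σ i : Fin k, Fin (a i) // v.1 ∈ S}) :=
    Function.Embedding.nonempty_of_card_le (by simpa using h3)
  obtain ⟨ψ⟩ : Nonempty (Fin 4 ↪ {v : Σ i : Fin k, Fin (a i) // v.1 ∈ Sᶜ}) :=
    Function.Embedding.nonempty_of_card_le (by simpa using h4)
  have hne (x : Fin 3) (y : Fin 4) : (φ x).1.1 ≠ (ψ y).1.1 := fun h =>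
    Finset.mem_compl.1 (ψ y).2 (h ▸ (φ x).2)
  let F : (Σ i : Fin 2, Fin (![3, 4] i)) → Σ i : Fin k, Fin (a i) := fun v =>
    match v with
    | ⟨0, x⟩ => (φ x).1
    | ⟨1, y⟩ => (ψ y).1
  refine ⟨⟨F, ?_⟩, ?_⟩
  · rintro ⟨u, x⟩ ⟨v, y⟩ huv
    have huv' : u ≠ v := huv
    match u, v, x, y, huv' with
    | 0, 0, _, _, h => exact (h rfl).elim
    | 1, 1, _, _, h => exact (h rfl).elim
    | 0, 1, x, y, _ => exact hne x y
    | 1, 0, x, y, _ => exact (hne y x).symm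
  · rintro ⟨u, x⟩ ⟨v, y⟩ huv
    match u, v, x, y, huv with
    | 0, 0, x, y, huv => rw [φ.injective (Subtype.ext huv)]
    | 0, 1, x, y, huv => exact (hne x y (congrArg Sigma.fst huv)).elim
    | 1, 0, x, y, huv => exact (hne y x (congrArg Sigma.fst huv.symm)).elim
    | 1, 1, x, y, huv => rw [ψ.injective (Subtype.ext huv)]

/-- Six vertices of which only the last two may share a part give `K_{1,1,1,1,2}`. -/
lemma contains_of_six {e : Fin 6 → Σ i : Fin k, Fin (a i)} (he : Function.Injective e)
    (hadj : ∀ i j, i ≠ j → min i 4 ≠ min j 4 → (e i).1 ≠ (e j).1) :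
    ContainsSubgraphIso (completeMultipartite a) (completeMultipartite ![1, 1, 1, 1, 2]) := by
  let F : (Σ i : Fin 5, Fin (![1, 1, 1, 1, 2] i)) → Fin 6 := fun v =>
    Fin.ofNat 6 (v.1.1 + v.2.1)
  have hF : Function.Injective F := by decide
  have hF' : ∀ u v, u.1 ≠ v.1 → F u ≠ F v ∧ min (F u) 4 ≠ min (F v) 4 := by decide
  exact ⟨⟨e ∘ F, fun {u v} huv => hadj _ _ (hF' u v huv).1 (hF' u v huv).2⟩, he.comp hF⟩

/-- At least five nonempty parts and at least six vertices give `K_{1,1,1,1,2}`. -/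
lemma contains_of_five_parts (ha : ∀ i, 0 < a i) (hk : 5 ≤ k) (h : 6 ≤ ∑ i, a i) :
    ContainsSubgraphIso (completeMultipartite a) (completeMultipartite ![1, 1, 1, 1, 2]) := by
  by_cases hone : ∃ i, 2 ≤ a i
  · obtain ⟨i, hi⟩ := hone
    obtain ⟨q, hq, hqi⟩ := exists_extension (n := 5) (by norm_num) (by simpa using hk)
      (p := fun _ : Fin 1 => i) (Function.injective_of_subsingleton _)
    have hq0 : q 0 = i := hqi 0
    have hqr : Function.Injective (q ∘ Fin.rev) := hq.comp Fin.rev_injective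
    have hlast : (q ∘ Fin.rev) (Fin.last 4) = i := hq0
    let e : Fin 6 → Σ i : Fin k, Fin (a i) :=
      Fin.snoc (fun j : Fin 5 => ⟨(q ∘ Fin.rev) j, 0, ha _⟩) ⟨i, 1, hi⟩
    have hfst : ∀ j, (e j).1 = (q ∘ Fin.rev) (Fin.ofNat 5 (min j.1 4)) := by
      intro j
      fin_cases j <;> first | rfl | exact hlast.symm
    have hmin : ∀ x y : Fin 6, Fin.ofNat 5 (min x.1 4) = Fin.ofNat 5 (min y.1 4) →
        min x 4 = min y 4 := by decide
    refine contains_of_six (e := e) (Fin.snoc_injective_iff.2 ⟨?_, ?_⟩) ?_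
    · exact fun x y hxy => hqr (congrArg Sigma.fst hxy)
    · rintro ⟨j, hj⟩
      have hj' := hj
      rw [Sigma.mk.injEq] at hj'
      obtain ⟨rfl, hj'⟩ := hj'
      simp at hj'
    · intro x y _ hxy
      rw [hfst, hfst]
      exact fun h => hxy (hmin x y (hqr h))
  · push Not at hone
    have hk6 : 6 ≤ k := by
      have : ∑ i, a i ≤ ∑ i : Fin k, 1 := Finset.sum_le_sum fun i _ => by have := hone i; omega
      simp at this
      omega
    refine contains_of_six (e := fun j => ⟨Fin.castLE hk6 j, 0, ha _⟩) ?_ ?_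
    · intro x y hxy
      simpa using congrArg Sigma.fst hxy
    · intro x y hxy _
      simpa using hxy

/-- With at least seven vertices and no part missing at most two of them there is a `K_{3,4}`. -/
lemma contains_three_four_of_seven_le (h : 7 ≤ ∑ i, a i) (hlarge : ∀ i, 3 ≤ ∑ j ∈ {i}ᶜ, a j) :
    ContainsSubgraphIso (completeMultipartite a) (completeMultipartite ![3, 4]) := by
  have hsum (S : Finset (Fin k)) : ∑ i ∈ S, a i + ∑ i ∈ Sᶜ, a i = ∑ i, a i :=
    Finset.sum_add_sum_compl S a
  have split (S : Finset (Fin k)) (h3 : 3 ≤ ∑ i ∈ S, a i) (h3' : 3 ≤ ∑ i ∈ Sᶜ, a i) :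
      ContainsSubgraphIso (completeMultipartite a) (completeMultipartite ![3, 4]) := by
    have := hsum S
    by_cases h4 : 4 ≤ ∑ i ∈ Sᶜ, a i
    · exact contains_three_four h3 h4
    · exact contains_three_four h3' (by rw [compl_compl]; omega)
  by_cases hbig : ∃ i, 3 ≤ a i
  · obtain ⟨i, hi⟩ := hbig
    exact split {i} (by simpa using hi) (hlarge i)
  · push Not at hbig
    obtain ⟨S, hS, hmin⟩ := exists_minimal_of_wellFoundedLT
      (fun S : Finset (Fin k) => 3 ≤ ∑ i ∈ S, a i) ⟨Finset.univ, by simpa using by omega⟩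
    have hS' : ∑ i ∈ S, a i ≤ 4 := by
      have hne : S.Nonempty := by
        rw [Finset.nonempty_iff_ne_empty]
        rintro rfl
        simp at hS
      obtain ⟨x, hx⟩ := hne
      have h1 := Finset.add_sum_erase S a hx
      have h2 : ¬ 3 ≤ ∑ i ∈ S.erase x, a i := fun h3 =>
        Finset.notMem_erase x S (hmin h3 (Finset.erase_subset x S) hx)
      have := hbig x
      omega
    have := hsum S
    exact split S hS (by omega)

end Combinatorics


/-- every complete multipartite graph (all parts nonempty) that is
not IC-planar contains a subgraph isomorphic to `K_{3,4}` or `K_{1,1,1,1,2}`. -/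
theorem stmt13 (k : ℕ) (a : Fin k → ℕ) (ha : ∀ i, 0 < a i)
    (h : ¬ (completeMultipartite a).ICPlanar) :
    ContainsSubgraphIso (completeMultipartite a) (completeMultipartite ![3, 4]) ∨
    ContainsSubgraphIso (completeMultipartite a) (completeMultipartite ![1, 1, 1, 1, 2]) := by
  by_cases hlarge : ∃ i, ∑ j ∈ {i}ᶜ, a j ≤ 2
  · obtain ⟨i, hi⟩ := hlarge
    exact (h (icPlanar_of_large_part i hi)).elim
  push Not at hlarge
  rcases lt_trichotomy (∑ i, a i) 6 with h6 | h6 | h6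
  · exact (h (icPlanar_of_card_le_five (by omega))).elim
  · by_cases hk : 5 ≤ k
    · exact Or.inr (contains_of_five_parts ha hk h6.ge)
    · have h3 : ∀ i, a i ≤ 2 := fun i => by
        by_contra! hi
        exact h (icPlanar_of_triple h6 hi)
      exfalso
      have h2 : ∃ i, 2 ≤ a i := by
        by_contra! hall
        have : ∑ i, a i ≤ ∑ i : Fin k, 1 := Finset.sum_le_sum fun i _ => by
          have := hall i
          omega
        simp at this
        omega
      obtain ⟨i, hi⟩ := h2
      have hle : ∑ j ∈ {i}ᶜ, a j ≤ ∑ j ∈ ({i}ᶜ : Finset (Fin k)), 1 :=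
        Finset.sum_le_sum fun j hj => by
          by_contra! h2
          exact h (icPlanar_of_two_pairs h6 (by simpa [eq_comm] using hj) hi h2)
      have hsum := Finset.sum_add_sum_compl {i} a
      have hi' := h3 i
      simp [Finset.card_compl] at hle hsum
      omega
  · exact Or.inl (contains_three_four_of_seven_le h6 hlarge)
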